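/- Let A be a unital C*-algebra with T(A) ≠ ∅ and let a ∈ A be a positive contraction which has tracial approximate oscillation zero. Then for every ε > 0 there exists a positive contraction b ∈ Her(a) such that for every tracial state τ ∈ T(A): τ(a) < τ(b) + ε and d_τ(b) − τ(f_{1/4}(b)) < ε. -/

import Mathlib

open scoped ComplexOrder

/-- A tracial state on a C*-algebra: a positive linear functional of norm one which is
tracial (`τ(xy) = τ(yx)`). -/
def IsTracialState {A : Type*} [NonUnitalNormedRing A] [StarRing A] [NormedSpace ℂ A]
    (τ : A →L[ℂ] ℂ) : Prop :=
  (∀ x : A, 0 ≤ τ (star x * x)) ∧ ‖τ‖ = 1 ∧ ∀ x y : A, τ (x * y) = τ (y * x)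

/-- The set `T(A)` of tracial states of `A`. -/
def traceSet (A : Type*) [CStarAlgebra A] : Set (A →L[ℂ] ℂ) := {τ | IsTracialState τ}

/-- The function `f_ε : ℝ → [0,1]`: `0` on `(-∞, ε]`, `1` on `[2ε, ∞)`, linear on `[ε, 2ε]`. -/
noncomputable def fE (ε : ℝ) : ℝ → ℝ := fun t => min 1 (max 0 ((t - ε) / ε))

variable {A : Type*} [CStarAlgebra A]

/-- `d_τ(a) := sup_n τ(f_{1/n}(a))`. -/
noncomputable def dTau (τ : A →L[ℂ] ℂ) (a : A) : ℝ :=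
  ⨆ n : ℕ, (τ (cfc (fE (1 / (n + 1 : ℝ))) a)).re

/-- The tracial oscillation `ω(a) = lim_n sup_{τ ∈ T(A)} (d_τ(a) − τ(f_{1/n}(a)))`; since the
sequence of suprema is nonincreasing, the limit is the infimum. -/
noncomputable def osc (a : A) : ℝ :=
  ⨅ n : ℕ, ⨆ τ : ↥(traceSet A),
    (dTau (τ : A →L[ℂ] ℂ) a - ((τ : A →L[ℂ] ℂ) (cfc (fE (1 / (n + 1 : ℝ))) a)).re)

/-- The tracial 2-seminorm `‖x‖₂ = sup_{τ ∈ T(A)} τ(x*x)^{1/2}`. -/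
noncomputable def norm2 (x : A) : ℝ :=
  ⨆ τ : ↥(traceSet A), Real.sqrt (((τ : A →L[ℂ] ℂ) (star x * x)).re)

/-- The hereditary C*-subalgebra generated by `a`, i.e. the norm closure of `aAa`. -/
def her (a : A) : Set A := closure {y : A | ∃ x : A, y = a * x * a}

/-- An element `a` has tracial approximate oscillation zero if for every `ε > 0` there is a
positive `c ∈ Her(a)` with `‖c‖ ≤ ‖a‖`, `‖a − c‖₂ < ε` and `ω(c) < ε`. -/
def TAOZero [PartialOrder A] [StarOrderedRing A] (a : A) : Prop :=
  ∀ ε > 0, ∃ c ∈ her a, 0 ≤ c ∧ ‖c‖ ≤ ‖a‖ ∧ norm2 (a - c) < ε ∧ osc c < ε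

section Cutoff

variable {ε δ t : ℝ}

lemma fE_nonneg (ε t : ℝ) : 0 ≤ fE ε t := le_min zero_le_one (le_max_left _ _)

lemma fE_le_one (ε t : ℝ) : fE ε t ≤ 1 := min_le_left _ _

lemma continuous_fE (ε : ℝ) : Continuous (fE ε) := by
  unfold fE
  fun_prop

lemma monotone_fE (hε : 0 < ε) : Monotone (fE ε) := fun s t hst ↦ by
  unfold fE
  gcongr

lemma fE_eq_zero (hε : 0 < ε) (ht : t ≤ ε) : fE ε t = 0 := by
  have : (t - ε) / ε ≤ 0 := div_nonpos_of_nonpos_of_nonneg (by linarith) hε.le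
  simp [fE, this]

lemma fE_eq_one (hε : 0 < ε) (ht : 2 * ε ≤ t) : fE ε t = 1 := by
  have : 1 ≤ (t - ε) / ε := by rw [le_div_iff₀ hε]; linarith
  simp [fE, this]

lemma fE_mul (hδ : 0 < δ) (ε t : ℝ) : fE ε (δ * t) = fE (ε / δ) t := by
  unfold fE
  congr 2
  rw [← mul_div_mul_left (t - ε / δ) (ε / δ) hδ.ne']
  congr 1 <;> field_simp

end Cutoff

/-- The elements `a * x * a`, as a star subalgebra, for self-adjoint `a`. -/
def sandwichSubalgebra (a : A) (ha : IsSelfAdjoint a) : NonUnitalStarSubalgebra ℝ A where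
  carrier := {y | ∃ x, y = a * x * a}
  add_mem' := by
    rintro _ _ ⟨x, rfl⟩ ⟨y, rfl⟩
    exact ⟨x + y, by noncomm_ring⟩
  zero_mem' := ⟨0, by simp⟩
  mul_mem' := by
    rintro _ _ ⟨x, rfl⟩ ⟨y, rfl⟩
    exact ⟨x * a * a * y, by noncomm_ring⟩
  smul_mem' := by
    rintro r _ ⟨x, rfl⟩
    exact ⟨r • x, by simp⟩
  star_mem' := by
    rintro _ ⟨x, rfl⟩
    exact ⟨star x, by simp [ha.star_eq, mul_assoc]⟩

lemma cfc_mem_her {a c : A} (ha : IsSelfAdjoint a) (hc : c ∈ her a) {f : ℝ → ℝ}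
    (hf : Continuous f) (hf0 : f 0 = 0) : cfc f c ∈ her a := by
  by_cases hcs : IsSelfAdjoint c
  · have hmem : c ∈ (sandwichSubalgebra a ha).topologicalClosure := hc
    rw [← cfcₙ_eq_cfc (hf := hf.continuousOn) (hf0 := hf0)]
    have := (sandwichSubalgebra a ha).isClosed_topologicalClosure
    exact cfcₙ_mem f hmem
  · rw [cfc_apply_of_not_predicate c hcs]
    exact (sandwichSubalgebra a ha).topologicalClosure.zero_mem

section TracialState

variable {τ : A →L[ℂ] ℂ}

lemma IsTracialState.re_nonneg [PartialOrder A] [StarOrderedRing A] (hτ : IsTracialState τ)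
    {x : A} (hx : 0 ≤ x) : 0 ≤ (τ x).re := by
  obtain ⟨y, rfl⟩ := CStarAlgebra.nonneg_iff_eq_star_mul_self.mp hx
  exact (Complex.nonneg_iff.mp (hτ.1 y)).1

lemma IsTracialState.re_mono [PartialOrder A] [StarOrderedRing A] (hτ : IsTracialState τ)
    {x y : A} (hxy : x ≤ y) : (τ x).re ≤ (τ y).re := by
  simpa using hτ.re_nonneg (sub_nonneg.mpr hxy)

lemma IsTracialState.re_le_norm (hτ : IsTracialState τ) (x : A) : (τ x).re ≤ ‖x‖ :=
  (Complex.re_le_norm _).trans <| by simpa [hτ.2.1] using τ.le_opNorm x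

lemma norm_one_le_one : ‖(1 : A)‖ ≤ 1 := by
  nontriviality A
  exact CStarRing.norm_one.le

lemma IsTracialState.re_cfc_le_one (hτ : IsTracialState τ) {f : ℝ → ℝ}
    (hf : ∀ t, ‖f t‖ ≤ 1) (x : A) : (τ (cfc f x)).re ≤ 1 :=
  (hτ.re_le_norm _).trans (norm_cfc_le zero_le_one fun t _ ↦ hf t)

lemma norm_fE_le_one (ε t : ℝ) : ‖fE ε t‖ ≤ 1 := by
  simpa [abs_of_nonneg (fE_nonneg ε t)] using fE_le_one ε t

lemma IsTracialState.re_cfc_fE_le_dTau (hτ : IsTracialState τ) (x : A) (n : ℕ) :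
    (τ (cfc (fE (1 / (n + 1 : ℝ))) x)).re ≤ dTau τ x :=
  le_ciSup (f := fun n : ℕ ↦ (τ (cfc (fE (1 / (n + 1 : ℝ))) x)).re)
    ⟨1, by rintro _ ⟨k, rfl⟩; exact hτ.re_cfc_le_one (norm_fE_le_one _) x⟩ n

lemma IsTracialState.dTau_le_one (hτ : IsTracialState τ) (x : A) : dTau τ x ≤ 1 :=
  ciSup_le fun _ ↦ hτ.re_cfc_le_one (norm_fE_le_one _) x

lemma IsTracialState.sq_re_le (hτ : IsTracialState τ) {x : A} (hx : IsSelfAdjoint x) :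
    (τ x).re ^ 2 ≤ (τ (star x * x)).re := by
  set s := (τ x).re with hs
  have h := (Complex.nonneg_iff.mp (hτ.1 (x - (s : ℂ) • 1))).1
  have h1 : (τ 1).re ≤ 1 := (hτ.re_le_norm 1).trans norm_one_le_one
  have hexp : star (x - (s : ℂ) • 1) * (x - (s : ℂ) • 1)
      = star x * x - (2 * s : ℂ) • x + (s ^ 2 : ℂ) • (1 : A) := by
    simp only [star_sub, star_smul, hx.star_eq, star_one, sub_mul, mul_sub, smul_mul_assoc,
      mul_smul_comm, one_mul, mul_one, RCLike.star_def, Complex.conj_ofReal]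
    module
  rw [hexp] at h
  have h2 : 0 ≤ (τ (star x * x)).re - 2 * s * s + s ^ 2 * (τ 1).re := by
    simpa [← Complex.ofReal_pow, hs, -star_mul] using h
  nlinarith [sq_nonneg s]

lemma IsTracialState.re_le_norm2 (hτ : IsTracialState τ) {x : A} (hx : IsSelfAdjoint x) :
    (τ x).re ≤ norm2 x := by
  have hbdd : BddAbove (Set.range fun τ : traceSet A ↦
      Real.sqrt (((τ : A →L[ℂ] ℂ) (star x * x)).re)) := by
    refine ⟨Real.sqrt ‖star x * x‖, ?_⟩
    rintro _ ⟨σ, rfl⟩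
    exact Real.sqrt_le_sqrt (σ.2.re_le_norm _)
  exact (Real.le_sqrt_of_sq_le (hτ.sq_re_le hx)).trans (le_ciSup hbdd ⟨τ, hτ⟩)

lemma exists_dTau_sub_lt_of_osc_lt [PartialOrder A] [StarOrderedRing A] {c : A} {ε : ℝ}
    (h : osc c < ε) :
    ∃ n : ℕ, ∀ τ : A →L[ℂ] ℂ, IsTracialState τ →
      dTau τ c - (τ (cfc (fE (1 / (n + 1 : ℝ))) c)).re < ε := by
  obtain ⟨n, hn⟩ := exists_lt_of_ciInf_lt h
  refine ⟨n, fun τ hτ ↦ lt_of_le_of_lt ?_ hn⟩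
  refine le_ciSup (f := fun τ : traceSet A ↦ dTau (τ : A →L[ℂ] ℂ) c -
    ((τ : A →L[ℂ] ℂ) (cfc (fE (1 / (n + 1 : ℝ))) c)).re) ⟨1, ?_⟩ ⟨τ, hτ⟩
  rintro _ ⟨σ, rfl⟩
  have h1 := σ.2.dTau_le_one c
  have h2 := σ.2.re_nonneg (cfc_nonneg (a := c) fun t _ ↦ fE_nonneg (1 / (n + 1 : ℝ)) t)
  dsimp only
  linarith

/-- Cutting `c` off by `t ↦ min 1 (N * t)` does not increase `d_τ`. -/
lemma IsTracialState.dTau_cfc_min_le [PartialOrder A] [StarOrderedRing A]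
    (hτ : IsTracialState τ) {c : A} (hc : IsSelfAdjoint c) (n : ℕ) :
    dTau τ (cfc (fun t : ℝ ↦ min 1 ((n + 1 : ℝ) * t)) c) ≤ dTau τ c := by
  refine ciSup_le fun k ↦ ?_
  refine le_trans (hτ.re_mono ?_) (hτ.re_cfc_fE_le_dTau c ((k + 1) * (n + 1) - 1))
  have hcast : (((k + 1) * (n + 1) - 1 : ℕ) : ℝ) + 1 = (k + 1) * (n + 1) := by
    rw [Nat.cast_sub (Nat.mul_pos k.succ_pos n.succ_pos)]
    push_cast
    ring
  rw [hcast, ← cfc_comp' _ _ c (continuous_fE _).continuousOn]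
  refine cfc_mono (fun t _ ↦ ?_) ((continuous_fE _).comp (by fun_prop)).continuousOn
    (continuous_fE _).continuousOn
  rw [← div_div, ← fE_mul (δ := n + 1) (by positivity)]
  exact monotone_fE (by positivity) (min_le_right _ _)

/-- Cutting `c` off by `t ↦ min 1 (N * t)` pushes the spectrum above `1 / N` to `1`. -/
lemma cfc_fE_le_cfc_fE_cfc_min [PartialOrder A] [StarOrderedRing A] {c : A}
    (hc : IsSelfAdjoint c) (n : ℕ) :
    cfc (fE (1 / (n + 1 : ℝ))) c ≤
      cfc (fE (1 / 4)) (cfc (fun t : ℝ ↦ min 1 ((n + 1 : ℝ) * t)) c) := by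
  rw [← cfc_comp' _ _ c (continuous_fE _).continuousOn]
  refine cfc_mono (fun t _ ↦ ?_) (continuous_fE _).continuousOn
    ((continuous_fE _).comp (by fun_prop)).continuousOn
  rcases le_total t (1 / (n + 1 : ℝ)) with ht | ht
  · rw [fE_eq_zero (by positivity) ht]
    exact fE_nonneg _ _
  · have : 1 ≤ (n + 1 : ℝ) * t := by rwa [div_le_iff₀' (by positivity)] at ht
    rw [min_eq_left this, fE_eq_one (t := 1) (by norm_num) (by norm_num)]
    exact fE_le_one _ _

lemma le_cfc_min [PartialOrder A] [StarOrderedRing A] {c : A} (hc : 0 ≤ c) (hc1 : ‖c‖ ≤ 1)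
    (n : ℕ) : c ≤ cfc (fun t : ℝ ↦ min 1 ((n + 1 : ℝ) * t)) c := by
  conv_lhs => rw [← cfc_id ℝ c]
  refine cfc_mono fun t ht ↦ le_min ?_ ?_
  · exact (le_abs_self t).trans <| (spectrum.norm_le_norm_mul_of_mem ht).trans <|
      mul_le_one₀ hc1 (norm_nonneg _) norm_one_le_one
  · have : 0 ≤ t := spectrum_nonneg_of_nonneg hc ht
    have : 0 ≤ n * t := by positivity
    simp only [id]
    linarith

end TracialState

/-- Lemma 3.11: if a positive contraction `a` has tracial approximate oscillation zero, then for
every `ε > 0` there is a positive contraction `b ∈ Her(a)` with `τ(a) < τ(b) + ε` and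
`d_τ(b) − τ(f_{1/4}(b)) < ε` for every tracial state `τ`. -/
theorem exists_small_oscillation_minorant [PartialOrder A] [StarOrderedRing A]
    (hT : (traceSet A).Nonempty)
    (a : A) (ha : 0 ≤ a) (ha1 : ‖a‖ ≤ 1) (haosc : TAOZero a)
    (ε : ℝ) (hε : 0 < ε) :
    ∃ b ∈ her a, 0 ≤ b ∧ ‖b‖ ≤ 1 ∧
      ∀ τ : A →L[ℂ] ℂ, IsTracialState τ →
        (τ a).re < (τ b).re + ε ∧
        dTau τ b - (τ (cfc (fE (1 / 4)) b)).re < ε := by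
  obtain ⟨c, hca, hc, hcn, hac, hosc⟩ := haosc ε hε
  obtain ⟨n, hn⟩ := exists_dTau_sub_lt_of_osc_lt hosc
  have hspec : ∀ t ∈ spectrum ℝ c, 0 ≤ min 1 ((n + 1 : ℝ) * t) := fun t ht ↦ by
    have := spectrum_nonneg_of_nonneg hc ht
    positivity
  refine ⟨cfc (fun t : ℝ ↦ min 1 ((n + 1 : ℝ) * t)) c,
    cfc_mem_her ha.isSelfAdjoint hca (by fun_prop) (by simp), cfc_nonneg hspec,
    norm_cfc_le zero_le_one fun t ht ↦ ?_, fun τ hτ ↦ ⟨?_, ?_⟩⟩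
  · rw [Real.norm_of_nonneg (hspec t ht)]
    exact min_le_left _ _
  · have h1 := hτ.re_le_norm2 (ha.isSelfAdjoint.sub hc.isSelfAdjoint)
    have h2 := hτ.re_mono (le_cfc_min hc (hcn.trans ha1) n)
    rw [map_sub, Complex.sub_re] at h1
    linarith
  · have h1 := hτ.dTau_cfc_min_le hc.isSelfAdjoint n
    have h2 := hτ.re_mono (cfc_fE_le_cfc_fE_cfc_min hc.isSelfAdjoint n)
    linarith [hn τ hτ]
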